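/- Let L be the weighted Laplacian matrix of a connected weighted undirected graph on n vertices, let D = diag(d₁,…,dₙ) with dᵢ > 0, and let v, I ∈ ℝⁿ. For κ > 0 define V(κ) = (L + κD)⁻¹(κD v + I) and the droop control u(κ) = κD(v − V(κ)). Then as κ → 0⁺, u(κ) → −((Σᵢ Iᵢ)/(Σᵢ dᵢ))·D·1ₙ; in particular, with D = F⁻¹ = diag(f₁⁻¹,…,fₙ⁻¹), u(κ) converges to the optimal injection u* = μ F⁻¹ 1ₙ with μ = −(Σᵢ Iᵢ)/(Σᵢ fᵢ⁻¹). -/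

import Mathlib

open Matrix Filter Topology Finset


lemma aux_sum (n : ℕ) (L : Matrix (Fin n) (Fin n) ℝ) (hsym : L.IsSymm)
    (hL1 : L *ᵥ (fun _ => (1 : ℝ)) = 0) (x : Fin n → ℝ) : ∑ i, (L *ᵥ x) i = 0 := by
  have h : (fun _ => (1 : ℝ)) ⬝ᵥ (L *ᵥ x) = 0 := by
    rw [Matrix.dotProduct_mulVec, ← Matrix.mulVec_transpose, hsym.eq, hL1, zero_dotProduct]
  simpa [dotProduct] using h

lemma aux_range (n : ℕ) (L : Matrix (Fin n) (Fin n) ℝ) (hsym : L.IsSymm)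
    (hL1 : L *ᵥ (fun _ => (1 : ℝ)) = 0)
    (hker : ∀ x : Fin n → ℝ, L *ᵥ x = 0 → ∃ c : ℝ, x = fun _ => c)
    (hn : 0 < n) (g : Fin n → ℝ) (hg : ∑ i, g i = 0) : ∃ y, L *ᵥ y = g := by
  have hn' : (n : ℝ) ≠ 0 := by positivity
  let f : (Fin n → ℝ) →ₗ[ℝ] (Fin n → ℝ) :=
    { toFun := fun x => L *ᵥ x + fun _ => ∑ i, x i
      map_add' := by
        intro x y
        ext i
        simp [Matrix.mulVec_add, Finset.sum_add_distrib]
        ring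
      map_smul' := by
        intro c x
        ext i
        simp [Matrix.mulVec_smul, Finset.mul_sum, mul_add] }
  have hf : ∀ x, f x = L *ᵥ x + fun _ => ∑ i, x i := fun x => rfl
  have key : ∀ x, ∑ i, (f x) i = 0 → f x = L *ᵥ x ∧ ∑ i, x i = 0 := by
    intro x hx
    have h0 : ∑ i, x i = 0 := by
      rw [hf] at hx
      simp only [Pi.add_apply, Finset.sum_add_distrib, aux_sum n L hsym hL1 x] at hx
      simpa [hn', hn.ne'] using hx
    refine ⟨?_, h0⟩
    rw [hf, h0]
    ext i
    simp
  have hinj : Function.Injective f := by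
    rw [injective_iff_map_eq_zero]
    intro x hx
    obtain ⟨h1, h2⟩ := key x (by simp [hx])
    obtain ⟨c, hc⟩ := hker x (by rw [← h1, hx])
    subst hc
    have : c = 0 := by simpa [hn'.symm, hn.ne'] using h2
    subst this
    rfl
  obtain ⟨y, hy⟩ := (LinearMap.injective_iff_surjective.mp hinj) g
  exact ⟨y, by rw [← (key y (by rw [hy, hg])).1, hy]⟩

/-- With `V(κ) = (L + κD)⁻¹(κD v + I)` and
`u(κ) = κD(v − V(κ))`, as `κ → 0⁺` one has
`u(κ) → −((Σᵢ Iᵢ)/(Σᵢ dᵢ))·D·1ₙ` (which, for `D = F⁻¹`, is the optimal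
injection `u* = μF⁻¹1ₙ` with `μ = −(Σᵢ Iᵢ)/(Σᵢ fᵢ⁻¹)`). -/
theorem stmt_8 (n : ℕ) (L : Matrix (Fin n) (Fin n) ℝ)
    (hsym : L.IsSymm) (hpsd : L.PosSemidef)
    (hL1 : L *ᵥ (fun _ => (1 : ℝ)) = 0)
    (hker : ∀ x : Fin n → ℝ, L *ᵥ x = 0 → ∃ c : ℝ, x = fun _ => c)
    (d : Fin n → ℝ) (hd : ∀ i, 0 < d i) (v I : Fin n → ℝ) :
    Tendsto
      (fun κ : ℝ =>
        κ • (Matrix.diagonal d *ᵥ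
          (v - (L + κ • Matrix.diagonal d)⁻¹ *ᵥ (κ • (Matrix.diagonal d *ᵥ v) + I))))
      (𝓝[>] 0)
      (𝓝 ((-(∑ i, I i) / (∑ i, d i)) • (Matrix.diagonal d *ᵥ fun _ => (1 : ℝ)))) := by
  rcases Nat.eq_zero_or_pos n with hn | hn
  · subst hn
    exact tendsto_const_nhds.congr (fun κ => Subsingleton.elim _ _)
  have : Nonempty (Fin n) := ⟨⟨0, hn⟩⟩
  have hS : 0 < ∑ i, d i := Finset.sum_pos (fun i _ => hd i) Finset.univ_nonempty
  set α : ℝ := (∑ i, I i) / (∑ i, d i) with hα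
  obtain ⟨y, hy⟩ := aux_range n L hsym hL1 hker hn (I - L *ᵥ v - α • d) (by
    simp only [Pi.sub_apply, Finset.sum_sub_distrib, aux_sum n L hsym hL1 v, Pi.smul_apply,
      smul_eq_mul, ← Finset.mul_sum]
    rw [hα]
    field_simp
    ring)
  rw [tendsto_pi_nhds]
  intro i
  set C : ℝ := ∑ j, d j * y j ^ 2 with hC
  rw [tendsto_iff_norm_sub_tendsto_zero]
  have hlim : Tendsto (fun κ : ℝ => κ * (d i * (|y i| + √(C / d i)))) (𝓝[>] 0) (𝓝 0) := by
    have h : Tendsto (fun κ : ℝ => κ * (d i * (|y i| + √(C / d i)))) (𝓝 0)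
        (𝓝 (0 * (d i * (|y i| + √(C / d i))))) := tendsto_id.mul_const _
    rw [zero_mul] at h
    exact h.mono_left nhdsWithin_le_nhds
  refine tendsto_of_tendsto_of_tendsto_of_le_of_le' tendsto_const_nhds hlim
    (Eventually.of_forall fun κ => norm_nonneg _) ?_
  filter_upwards [self_mem_nhdsWithin] with κ hκ
  have hκ : 0 < κ := hκ
  have hpd : (L + κ • Matrix.diagonal d).PosDef :=
    Matrix.PosDef.posSemidef_add hpsd ((Matrix.PosDef.diagonal hd).smul hκ)
  have hu : IsUnit (L + κ • Matrix.diagonal d).det := (Matrix.isUnit_iff_isUnit_det _).1 hpd.isUnit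
  set V := (L + κ • Matrix.diagonal d)⁻¹ *ᵥ (κ • (Matrix.diagonal d *ᵥ v) + I) with hV
  have hVeq : (L + κ • Matrix.diagonal d) *ᵥ V = κ • (Matrix.diagonal d *ᵥ v) + I := by
    rw [hV, Matrix.mulVec_mulVec, Matrix.mul_nonsing_inv _ hu, Matrix.one_mulVec]
  have hVi : ∀ j, (L *ᵥ V) j + κ * (d j * V j) = κ * (d j * v j) + I j := by
    intro j
    have := congrFun hVeq j
    simpa [Matrix.add_mulVec, Matrix.smul_mulVec, Matrix.mulVec_diagonal] using this
  have hyi : ∀ j, (L *ᵥ y) j = I j - (L *ᵥ v) j - α * d j := by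
    intro j
    have := congrFun hy j
    simpa using this
  -- the bounded remainder
  set z : Fin n → ℝ := V - v - (α / κ) • (fun _ => (1 : ℝ)) - y with hz
  have hLz : ∀ j, (L *ᵥ z) j = (L *ᵥ V) j - (L *ᵥ v) j - (L *ᵥ y) j := by
    intro j
    rw [hz, Matrix.mulVec_sub, Matrix.mulVec_sub, Matrix.mulVec_sub, Matrix.mulVec_smul, hL1]
    simp
  have hzj : ∀ j, z j = V j - v j - α / κ - y j := by
    intro j
    simp [hz]
  have hzeq : ∀ j, (L *ᵥ z) j = - κ * (d j * (z j + y j)) := by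
    intro j
    rw [hLz, hyi, hzj]
    have := hVi j
    field_simp
    linarith
  have hen : 0 ≤ ∑ j, z j * (L *ᵥ z) j := by
    have := hpsd.dotProduct_mulVec_nonneg z
    simpa [dotProduct] using this
  have hen2 : ∑ j, d j * (z j * (z j + y j)) ≤ 0 := by
    have h : ∑ j, z j * (L *ᵥ z) j = - κ * ∑ j, d j * (z j * (z j + y j)) := by
      rw [Finset.mul_sum]
      refine Finset.sum_congr rfl fun j _ => ?_
      rw [hzeq]
      ring
    rw [h] at hen
    by_contra! hc
    nlinarith [mul_pos hκ hc]
  have hbd : ∑ j, d j * z j ^ 2 ≤ C := by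
    have h : ∑ j, (d j * z j ^ 2 - d j * y j ^ 2) ≤ ∑ j, 2 * (d j * (z j * (z j + y j))) := by
      refine Finset.sum_le_sum fun j _ => ?_
      nlinarith [mul_nonneg (hd j).le (sq_nonneg (z j + y j))]
    rw [Finset.sum_sub_distrib, ← Finset.mul_sum] at h
    linarith
  have hzi : |z i| ≤ √(C / d i) := by
    apply Real.abs_le_sqrt
    rw [le_div_iff₀ (hd i)]
    have h := Finset.single_le_sum (f := fun j => d j * z j ^ 2)
      (fun j _ => mul_nonneg (hd j).le (sq_nonneg (z j))) (Finset.mem_univ i)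
    linarith
  have hfin : (κ • (Matrix.diagonal d *ᵥ (v - V))) i -
      ((-(∑ i, I i) / (∑ i, d i)) • (Matrix.diagonal d *ᵥ fun _ => (1 : ℝ))) i
      = - (κ * (d i * (y i + z i))) := by
    simp only [Pi.smul_apply, Matrix.mulVec_diagonal, smul_eq_mul, Pi.sub_apply, neg_div, ← hα]
    rw [hzj]
    field_simp
    ring
  rw [hfin, norm_neg, Real.norm_eq_abs, abs_mul, abs_mul, abs_of_pos hκ, abs_of_pos (hd i)]
  have := hd i
  gcongr
  exact (abs_add_le _ _).trans (by gcongr)
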